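/- Let I be a normally torsion-free square-free monomial ideal in R = K[x_1,...,x_n] and h a square-free monomial such that there exist variables x_r ≠ x_s with gcd(h,u) ∈ {1, x_r, x_r x_s} for every minimal generator u of I. Then the ideal I + (h) is normally torsion-free. -/

import Mathlib

open MvPolynomial

variable {K : Type*} [Field K] {n : ℕ}

/-- `I` is a square-free monomial ideal. -/
def IsSqFreeMonomialIdeal (I : Ideal (MvPolynomial (Fin n) K)) : Prop :=
  ∃ S : Set (Finset (Fin n)), I = Ideal.span ((fun s => ∏ i ∈ s, X i) '' S)

/-- The square-free monomial `∏_{i ∈ s} x_i` is a minimal generator of `I`. -/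
def IsMinGen (I : Ideal (MvPolynomial (Fin n) K)) (s : Finset (Fin n)) : Prop :=
  (∏ i ∈ s, X i) ∈ I ∧ ∀ t : Finset (Fin n), t ⊂ s → (∏ i ∈ t, (X i : MvPolynomial (Fin n) K)) ∉ I

/-- `I` is normally torsion-free. -/
def NormallyTorsionFree (I : Ideal (MvPolynomial (Fin n) K)) : Prop :=
  ∀ k : ℕ, 1 ≤ k →
    associatedPrimes (MvPolynomial (Fin n) K) (MvPolynomial (Fin n) K ⧸ I ^ k) ⊆
      associatedPrimes (MvPolynomial (Fin n) K) (MvPolynomial (Fin n) K ⧸ I)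

section Order

/-- The order of `f` along the variables in `D`, that is, the largest `k` with
`f ∈ (x_i : i ∈ D) ^ k`. -/
noncomputable def orderAlong (D : Finset (Fin n)) (f : MvPolynomial (Fin n) K) : ℕ∞ :=
  (f : MvPowerSeries (Fin n) K).weightedOrder (fun i => if i ∈ D then 1 else 0)

lemma weight_indicator (D : Finset (Fin n)) (m : Fin n →₀ ℕ) :
    Finsupp.weight (fun i => if i ∈ D then 1 else 0) m = ∑ i ∈ D, m i := by
  rw [Finsupp.weight_apply, Finsupp.sum_fintype _ _ (by simp)]
  simp

lemma le_orderAlong_iff {D : Finset (Fin n)} {f : MvPolynomial (Fin n) K} {k : ℕ} :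
    (k : ℕ∞) ≤ orderAlong D f ↔ ∀ m ∈ f.support, k ≤ ∑ i ∈ D, m i := by
  constructor
  · intro h m hm
    rw [← weight_indicator]
    have := MvPowerSeries.weightedOrder_le (f := (f : MvPowerSeries (Fin n) K))
      (fun i => if i ∈ D then 1 else 0) (d := m) (by simpa using hm)
    exact_mod_cast h.trans this
  · intro h
    refine MvPowerSeries.nat_le_weightedOrder _ fun d hd => ?_
    rw [weight_indicator] at hd
    by_contra hne
    have := h d (by simpa using hne)
    omega

lemma orderAlong_mul (D : Finset (Fin n)) (f g : MvPolynomial (Fin n) K) :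
    orderAlong D (f * g) = orderAlong D f + orderAlong D g := by
  simp [orderAlong, MvPowerSeries.weightedOrder_mul]

lemma min_orderAlong_le_add (D : Finset (Fin n)) (f g : MvPolynomial (Fin n) K) :
    min (orderAlong D f) (orderAlong D g) ≤ orderAlong D (f + g) := by
  simpa [orderAlong] using MvPowerSeries.min_weightedOrder_le_add _

/-- The ideal of polynomials whose order along `D` is at least `k`. -/
noncomputable def orderIdeal (K : Type*) [Field K] (D : Finset (Fin n)) (k : ℕ∞) :
    Ideal (MvPolynomial (Fin n) K) where
  carrier := {f | k ≤ orderAlong D f}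
  zero_mem' := by simp [orderAlong]
  add_mem' ha hb := (le_min ha hb).trans (min_orderAlong_le_add D _ _)
  smul_mem' c f hf := by
    simp only [Set.mem_ofPred_eq, smul_eq_mul, orderAlong_mul] at hf ⊢
    exact hf.trans le_add_self

lemma mem_orderIdeal {D : Finset (Fin n)} {k : ℕ∞} {f : MvPolynomial (Fin n) K} :
    f ∈ orderIdeal K D k ↔ k ≤ orderAlong D f := Iff.rfl

lemma mem_span_X_iff {D : Finset (Fin n)} {f : MvPolynomial (Fin n) K} :
    f ∈ Ideal.span (X '' (D : Set (Fin n)) : Set (MvPolynomial (Fin n) K)) ↔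
      1 ≤ orderAlong D f := by
  rw [mem_ideal_span_X_image, ← Nat.cast_one, le_orderAlong_iff]
  refine forall₂_congr fun m _ => ?_
  rw [Nat.one_le_iff_ne_zero, Ne, Finset.sum_eq_zero_iff]
  simp

lemma one_le_orderAlong_X {D : Finset (Fin n)} {i : Fin n} (hi : i ∈ D) :
    1 ≤ orderAlong D (X i : MvPolynomial (Fin n) K) :=
  mem_span_X_iff.mp (Ideal.subset_span ⟨i, by simpa using hi, rfl⟩)

lemma prod_X_eq_monomial (t : Finset (Fin n)) : ∏ i ∈ t, (X i : MvPolynomial (Fin n) K) =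
    monomial (∑ i ∈ t, Finsupp.single i 1) 1 := by
  rw [monomial_sum_one]
  rfl

lemma not_one_le_orderAlong_prod_X {D t : Finset (Fin n)} (h : Disjoint t D) :
    ¬ 1 ≤ orderAlong D (∏ i ∈ t, (X i : MvPolynomial (Fin n) K)) := by
  rw [prod_X_eq_monomial, ← Nat.cast_one, le_orderAlong_iff]
  intro H
  have := H (∑ i ∈ t, Finsupp.single i 1) (by simp [mem_support_iff])
  rw [Nat.one_le_iff_ne_zero, Ne, Finset.sum_eq_zero_iff] at this
  refine this fun i hi => ?_
  rw [Finsupp.finsetSum_apply]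
  refine Finset.sum_eq_zero fun j hj => ?_
  rw [Finsupp.single_eq_of_ne]
  rintro rfl
  exact Finset.disjoint_left.mp h hj hi

end Order

section EdgeIdeal

/-- The square-free monomial ideal generated by the edges of the hypergraph `M`. -/
noncomputable def edgeIdeal (K : Type*) [Field K] (M : Set (Finset (Fin n))) :
    Ideal (MvPolynomial (Fin n) K) :=
  Ideal.span ((fun t => ∏ i ∈ t, X i) '' M)

/-- `D` is a vertex cover of the hypergraph `M`. -/
def IsVertexCover (M : Set (Finset (Fin n))) (D : Finset (Fin n)) : Prop :=
  ∀ t ∈ M, ∃ i ∈ t, i ∈ D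

variable {M : Set (Finset (Fin n))}

lemma prod_X_mem_edgeIdeal {t : Finset (Fin n)} (ht : t ∈ M) :
    ∏ i ∈ t, (X i : MvPolynomial (Fin n) K) ∈ edgeIdeal K M :=
  Ideal.subset_span ⟨t, ht, rfl⟩

lemma mem_edgeIdeal_iff {f : MvPolynomial (Fin n) K} :
    f ∈ edgeIdeal K M ↔ ∀ m ∈ f.support, ∃ t ∈ M, t ⊆ m.support := by
  have h := mem_ideal_span_monomial_image (x := f)
    (s := (fun t : Finset (Fin n) => ∑ i ∈ t, Finsupp.single i 1) '' M)
  rw [Set.image_image] at h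
  simp only [edgeIdeal, prod_X_eq_monomial]
  rw [h]
  refine forall₂_congr fun m _ => ?_
  simp only [Set.exists_mem_image]
  refine exists_congr fun t => and_congr_right fun _ => ?_
  have hap : ∀ i, (∑ j ∈ t, Finsupp.single j 1 : Fin n →₀ ℕ) i = if i ∈ t then 1 else 0 := by
    intro i
    rw [Finsupp.finsetSum_apply]
    simp [Finsupp.single_apply]
  simp only [Finsupp.le_def, hap]
  constructor
  · intro H i hi
    have := H i
    simp only [hi, if_true] at this
    simp; omega
  · intro H i
    split_ifs with hi
    · have := H hi
      simp at this; omega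
    · exact Nat.zero_le _

lemma edgeIdeal_pow_le_orderIdeal {D : Finset (Fin n)} (hD : IsVertexCover M D) (k : ℕ) :
    edgeIdeal K M ^ k ≤ orderIdeal K D k := by
  have hone : edgeIdeal K M ≤ orderIdeal K D 1 := by
    refine Ideal.span_le.mpr ?_
    rintro _ ⟨t, ht, rfl⟩
    obtain ⟨i, hit, hiD⟩ := hD t ht
    exact Ideal.mem_of_dvd _ (Finset.dvd_prod_of_mem _ hit) (one_le_orderAlong_X hiD)
  induction k with
  | zero => exact fun f _ => by simp [mem_orderIdeal]
  | succ k ih =>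
    rw [pow_succ, Ideal.mul_le]
    intro f hf g hg
    rw [mem_orderIdeal, orderAlong_mul, Nat.cast_succ]
    exact add_le_add (ih hf) (hone hg)

lemma mem_edgeIdeal_of_sq_mem {f : MvPolynomial (Fin n) K} (h : f * f ∈ edgeIdeal K M) :
    f ∈ edgeIdeal K M := by
  rw [mem_edgeIdeal_iff]
  intro m hm
  by_contra! hc
  have hD : IsVertexCover M m.supportᶜ := by
    intro t ht
    obtain ⟨i, hi, him⟩ := Finset.not_subset.mp (hc t ht)
    exact ⟨i, hi, Finset.mem_compl.mpr him⟩
  have h2 := edgeIdeal_pow_le_orderIdeal hD 1 (by simpa using h)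
  rw [mem_orderIdeal, orderAlong_mul] at h2
  have h1 : ((1 : ℕ) : ℕ∞) ≤ orderAlong m.supportᶜ f := by
    by_contra hlt
    rw [Nat.cast_one, Order.one_le_iff_ne_zero, not_not] at hlt
    simp [hlt] at h2
  have := le_orderAlong_iff.mp h1 m hm
  rw [Nat.one_le_iff_ne_zero, Ne, Finset.sum_eq_zero_iff] at this
  exact this fun i hi => by simpa using hi

lemma exists_inter_eq_singleton {D : Finset (Fin n)} (hD : Minimal (IsVertexCover M) D)
    {i : Fin n} (hi : i ∈ D) : ∃ t ∈ M, i ∈ t ∧ ∀ j ∈ t, j ∈ D → j = i := by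
  have := hD.not_prop_of_lt (Finset.erase_ssubset hi)
  simp only [IsVertexCover, not_forall, not_exists, not_and] at this
  obtain ⟨t, ht, hti⟩ := this
  have hj : ∀ j ∈ t, j ∈ D → j = i := fun j hjt hjD => by
    by_contra hne
    exact hti j hjt (Finset.mem_erase.mpr ⟨hne, hjD⟩)
  obtain ⟨j, hjt, hjD⟩ := hD.prop t ht
  exact ⟨t, ht, hj j hjt hjD ▸ hjt, hj⟩

lemma exists_minimal_vertexCover_subset {D : Finset (Fin n)} (hD : IsVertexCover M D) :
    ∃ D' ⊆ D, Minimal (IsVertexCover M) D' :=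
  exists_minimal_le_of_wellFoundedLT _ D hD

end EdgeIdeal

section AssociatedPrimes

lemma mem_associatedPrimes_quotient_iff {I Q : Ideal (MvPolynomial (Fin n) K)} :
    Q ∈ associatedPrimes (MvPolynomial (Fin n) K) (MvPolynomial (Fin n) K ⧸ I) ↔
      Q.IsPrime ∧ ∃ f, ∀ a, a ∈ Q ↔ a * f ∈ I := by
  rw [AssociatedPrimes.mem_iff, isAssociatedPrime_iff]
  refine and_congr_right fun _ => ?_
  rw [Ideal.Quotient.mk_surjective.exists]
  refine exists_congr fun f => ?_
  rw [SetLike.ext_iff]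
  refine forall_congr' fun a => ?_
  rw [Submodule.mem_colon_singleton, Submodule.mem_bot]
  exact iff_congr Iff.rfl (Ideal.Quotient.eq_zero_iff_mem (I := I) (a := a * f))

variable {M : Set (Finset (Fin n))}

lemma span_X_mem_associatedPrimes {D : Finset (Fin n)} (hD : Minimal (IsVertexCover M) D)
    (hP : (Ideal.span (X '' (D : Set (Fin n))) : Ideal (MvPolynomial (Fin n) K)).IsPrime) :
    Ideal.span (X '' (D : Set (Fin n))) ∈ associatedPrimes (MvPolynomial (Fin n) K)
      (MvPolynomial (Fin n) K ⧸ edgeIdeal K M) := by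
  classical
  refine mem_associatedPrimes_quotient_iff.mpr ⟨hP, ∏ i ∈ Dᶜ, X i, fun a => ⟨fun ha => ?_,
    fun ha => ?_⟩⟩
  · have hle : Ideal.span (X '' (D : Set (Fin n))) ≤
        (edgeIdeal K M).colon {∏ i ∈ Dᶜ, (X i : MvPolynomial (Fin n) K)} := by
      refine Ideal.span_le.mpr ?_
      rintro _ ⟨i, hi, rfl⟩
      rw [SetLike.mem_coe, Submodule.mem_colon_singleton, smul_eq_mul,
        ← Finset.prod_insert (by simpa using hi)]
      obtain ⟨t, ht, -, hti⟩ := exists_inter_eq_singleton hD hi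
      refine Ideal.mem_of_dvd _ (Finset.prod_dvd_prod_of_subset t _ _ fun j hj => ?_)
        (prod_X_mem_edgeIdeal ht)
      by_cases hjD : j ∈ D
      · simp [hti j hj hjD]
      · simp [hjD]
    exact Submodule.mem_colon_singleton.mp (hle ha)
  · have h := edgeIdeal_pow_le_orderIdeal hD.prop 1 (by simpa using ha)
    rw [mem_orderIdeal, orderAlong_mul, Nat.cast_one] at h
    rw [mem_span_X_iff]
    have h0 := not_one_le_orderAlong_prod_X (K := K) (disjoint_compl_left (a := D))
    rw [Order.one_le_iff_ne_zero, not_not] at h0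
    simpa [h0] using h

variable (K) in
/-- The hypergraph `M` packs: a monomial whose weight on every vertex cover is at least `k`
lies in the `k`-th power of the edge ideal of `M`. -/
def IsMengerian (M : Set (Finset (Fin n))) : Prop :=
  ∀ (k : ℕ) (w : Fin n →₀ ℕ), (∀ D, IsVertexCover M D → k ≤ ∑ i ∈ D, w i) →
    monomial w 1 ∈ edgeIdeal K M ^ k

lemma isMengerian_of_normallyTorsionFree (h : NormallyTorsionFree (edgeIdeal K M)) :
    IsMengerian K M := by
  classical
  intro k w hw
  by_contra hmem
  rcases Nat.eq_zero_or_pos k with rfl | hk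
  · simp at hmem
  have hne : Ideal.Quotient.mk (edgeIdeal K M ^ k) (monomial w 1) ≠ 0 := by
    rwa [Ne, Ideal.Quotient.eq_zero_iff_mem]
  obtain ⟨Q, hQ, hle⟩ := exists_le_isAssociatedPrime_of_isNoetherianRing
    (MvPolynomial (Fin n) K) _ hne
  obtain ⟨hQp, f, hf⟩ := mem_associatedPrimes_quotient_iff.mp (h k hk hQ)
  have hfQ : f ∉ Q := fun hfQ => hQp.ne_top <| (Ideal.eq_top_iff_one _).mpr <|
    (hf 1).mpr <| by simpa using mem_edgeIdeal_of_sq_mem ((hf f).mp hfQ)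
  let D : Finset (Fin n) := Finset.univ.filter fun i => (X i : MvPolynomial (Fin n) K) ∈ Q
  have hD : IsVertexCover M D := by
    intro t ht
    have htQ : ∏ i ∈ t, (X i : MvPolynomial (Fin n) K) ∈ Q :=
      (hf _).mpr (Ideal.mul_mem_right _ _ (prod_X_mem_edgeIdeal ht))
    obtain ⟨i, hi, hiQ⟩ := hQp.prod_mem_iff.mp htQ
    exact ⟨i, hi, by simpa [D] using hiQ⟩
  refine hfQ (hQp.mem_of_pow_mem (∑ i ∈ D, w i) (hle ?_))
  rw [Submodule.mem_colon_singleton, Submodule.mem_bot]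
  refine Ideal.Quotient.eq_zero_iff_mem.mpr (Ideal.pow_le_pow_right (hw D hD) ?_)
  have hprod : ∏ i ∈ D, ((X i : MvPolynomial (Fin n) K) * f) ^ w i ∈
      edgeIdeal K M ^ ∑ i ∈ D, w i := by
    rw [← Finset.prod_pow_eq_pow_sum]
    exact Ideal.prod_mem_prod fun i hi =>
      Ideal.pow_mem_pow ((hf _).mp (by simpa [D] using hi)) _
  refine Ideal.mem_of_dvd _ ?_ hprod
  simp_rw [mul_pow]
  rw [Finset.prod_mul_distrib, Finset.prod_pow_eq_pow_sum, mul_comm]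
  refine mul_dvd_mul_left _ ?_
  rw [monomial_eq, Finsupp.prod_fintype _ _ (by simp), C_1, one_mul]
  exact Finset.prod_dvd_prod_of_subset _ _ _ (Finset.subset_univ _)

lemma IsMengerian.mem_pow {k : ℕ} (h : IsMengerian K M) {f : MvPolynomial (Fin n) K}
    (hf : ∀ D, Minimal (IsVertexCover M) D → (k : ℕ∞) ≤ orderAlong D f) :
    f ∈ edgeIdeal K M ^ k := by
  rw [f.as_sum]
  refine Ideal.sum_mem _ fun m hm => ?_
  rw [← mul_one (coeff m f), ← C_mul_monomial]
  refine Ideal.mul_mem_left _ _ (h k m fun D hD => ?_)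
  obtain ⟨D', hD', hmin⟩ := exists_minimal_vertexCover_subset hD
  exact (le_orderAlong_iff.mp (hf D' hmin) m hm).trans (Finset.sum_le_sum_of_subset hD')

lemma IsMengerian.normallyTorsionFree (h : IsMengerian K M) :
    NormallyTorsionFree (edgeIdeal K M) := by
  classical
  intro k _ Q hQ
  obtain ⟨hQp, f, hf⟩ := mem_associatedPrimes_quotient_iff.mp hQ
  let g : MvPolynomial (Fin n) K :=
    ∏ i ∈ Finset.univ.filter (fun i => (X i : MvPolynomial (Fin n) K) ∉ Q), X i
  have hg : g ∉ Q := by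
    rw [hQp.prod_mem_iff]
    simp
  have hgk : g ^ k * f ∉ edgeIdeal K M ^ k := fun hc =>
    hg (hQp.mem_of_pow_mem k ((hf _).mpr hc))
  obtain ⟨D, hD, hlt⟩ : ∃ D, Minimal (IsVertexCover M) D ∧
      ¬ (k : ℕ∞) ≤ orderAlong D (g ^ k * f) := by
    by_contra! hc
    exact hgk (h.mem_pow hc)
  rw [orderAlong_mul] at hlt
  have hDQ : ∀ i ∈ D, (X i : MvPolynomial (Fin n) K) ∈ Q := by
    intro i hi
    by_contra hiQ
    have hgD : ∀ j : ℕ, (j : ℕ∞) ≤ orderAlong D (g ^ j) := by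
      intro j
      induction j with
      | zero => simp
      | succ j ih =>
        rw [pow_succ, orderAlong_mul, Nat.cast_succ]
        refine add_le_add ih ?_
        exact Ideal.mem_of_dvd (orderIdeal K D 1)
          (Finset.dvd_prod_of_mem _ (by simpa using hiQ)) (one_le_orderAlong_X hi)
    exact hlt ((hgD k).trans le_self_add)
  have hQD : Q = Ideal.span (X '' (D : Set (Fin n))) := by
    refine le_antisymm (fun a ha => ?_) (Ideal.span_le.mpr ?_)
    · have hak := edgeIdeal_pow_le_orderIdeal hD.prop k ((hf a).mp ha)
      rw [mem_orderIdeal, orderAlong_mul] at hak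
      rw [mem_span_X_iff, Order.one_le_iff_ne_zero]
      intro h0
      rw [h0, zero_add] at hak
      exact hlt (hak.trans le_add_self)
    · rintro _ ⟨i, hi, rfl⟩
      exact hDQ i hi
  subst hQD
  exact span_X_mem_associatedPrimes hD hQp

end AssociatedPrimes

lemma IsMengerian.insert_edge {M : Set (Finset (Fin n))} (h : IsMengerian K M) {e : Finset (Fin n)}
    (he : ∀ D, Minimal (IsVertexCover M) D → (D ∩ e).card ≤ 1) :
    IsMengerian K (insert e M) := by
  intro k w hw
  have hmono : edgeIdeal K M ≤ edgeIdeal K (insert e M) :=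
    Ideal.span_mono (Set.image_mono (Set.subset_insert _ _))
  have heI : ∏ i ∈ e, (X i : MvPolynomial (Fin n) K) ∈ edgeIdeal K (insert e M) :=
    prod_X_mem_edgeIdeal (Set.mem_insert _ _)
  rcases e.eq_empty_or_nonempty with rfl | hne
  · rw [Finset.prod_empty, ← Ideal.eq_top_iff_one] at heI
    simp [heI, Ideal.top_pow]
  obtain ⟨i₀, hi₀, hmin⟩ := e.exists_min_image w hne
  let u : Fin n →₀ ℕ := ∑ i ∈ e, Finsupp.single i (w i₀)
  have hu : ∀ i, u i = if i ∈ e then w i₀ else 0 := by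
    intro i
    simp [u, Finsupp.finsetSum_apply, Finsupp.single_apply]
  have huw : u ≤ w := by
    intro i
    rw [hu]
    split_ifs with hi
    · exact hmin i hi
    · exact Nat.zero_le _
  have hv : monomial (w - u) 1 ∈ edgeIdeal K M ^ (k - w i₀) := by
    refine h _ _ fun D' hD' => ?_
    obtain ⟨D, hDD', hD⟩ := exists_minimal_vertexCover_subset hD'
    refine le_trans ?_ (Finset.sum_le_sum_of_subset hDD')
    have hsum : ∑ i ∈ D, (w - u) i + (D ∩ e).card * w i₀ = ∑ i ∈ D, w i := by
      have hcard : (D ∩ e).card * w i₀ = ∑ i ∈ D, u i := by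
        simp [hu, Finset.sum_ite_mem]
      rw [hcard, ← Finset.sum_add_distrib]
      exact Finset.sum_congr rfl fun i _ => Nat.sub_add_cancel (huw i)
    have hc := he D hD
    rcases (D ∩ e).eq_empty_or_nonempty with h0 | ⟨i, hi⟩
    · rw [h0] at hsum
      have hcov : IsVertexCover (insert e M) (insert i₀ D) := by
        rintro t (rfl | ht)
        · exact ⟨i₀, hi₀, by simp⟩
        · obtain ⟨j, hjt, hjD⟩ := hD.prop t ht
          exact ⟨j, hjt, by simp [hjD]⟩
      have hk := hw _ hcov
      have hi₀D : i₀ ∉ D := fun hc => by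
        have : i₀ ∈ D ∩ e := Finset.mem_inter.mpr ⟨hc, hi₀⟩
        simp [h0] at this
      rw [Finset.sum_insert hi₀D] at hk
      simp only [Finset.card_empty, zero_mul, add_zero] at hsum
      omega
    · have hcov : IsVertexCover (insert e M) D := by
        rintro t (rfl | ht)
        · exact ⟨i, Finset.mem_of_mem_inter_right hi, Finset.mem_of_mem_inter_left hi⟩
        · exact hD.prop t ht
      have hk := hw _ hcov
      have hle : (D ∩ e).card * w i₀ ≤ 1 * w i₀ := Nat.mul_le_mul_right _ hc
      omega
  have hwu : monomial w (1 : K) = (∏ i ∈ e, X i) ^ w i₀ * monomial (w - u) 1 := by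
    have hpu : (∏ i ∈ e, (X i : MvPolynomial (Fin n) K)) ^ w i₀ = monomial u 1 := by
      simp only [u, monomial_sum_one, ← Finset.prod_pow, X_pow_eq_monomial]
    rw [hpu, monomial_mul, one_mul, add_tsub_cancel_of_le huw]
  rw [hwu]
  refine Ideal.pow_le_pow_right (show k ≤ w i₀ + (k - w i₀) by omega) ?_
  rw [pow_add]
  exact Ideal.mul_mem_mul (Ideal.pow_mem_pow heI _) (Ideal.pow_right_mono hmono _ hv)

lemma card_minimal_vertexCover_inter_le_one {M : Set (Finset (Fin n))} {e : Finset (Fin n)}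
    {r s : Fin n} (he : ∀ t ∈ M, e ∩ t = ∅ ∨ e ∩ t = {r} ∨ e ∩ t = {r, s})
    {D : Finset (Fin n)} (hD : Minimal (IsVertexCover M) D) : (D ∩ e).card ≤ 1 := by
  have key : ∀ i ∈ D ∩ e, i = r ∨ i = s ∧ r ∉ D ∩ e := by
    intro i hi
    rw [Finset.mem_inter] at hi
    obtain ⟨t, ht, hit, htD⟩ := exists_inter_eq_singleton hD hi.1
    have hie : i ∈ e ∩ t := Finset.mem_inter.mpr ⟨hi.2, hit⟩
    rcases he t ht with h | h | h
    · simp [h] at hie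
    · exact Or.inl (by simpa [h] using hie)
    · have hr : r ∈ e ∩ t := by simp [h]
      rw [h, Finset.mem_insert, Finset.mem_singleton] at hie
      by_cases hir : i = r
      · exact Or.inl hir
      · refine Or.inr ⟨hie.resolve_left hir, fun hrD => hir ?_⟩
        exact (htD r (Finset.mem_of_mem_inter_right hr) (Finset.mem_of_mem_inter_left hrD)).symm
  rw [Finset.card_le_one]
  intro a ha b hb
  rcases key a ha with rfl | ⟨rfl, hr⟩ <;> rcases key b hb with rfl | ⟨rfl, hr'⟩ <;>
    first | rfl | contradiction

lemma IsSqFreeMonomialIdeal.eq_edgeIdeal_minGen {I : Ideal (MvPolynomial (Fin n) K)}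
    (hI : IsSqFreeMonomialIdeal I) : I = edgeIdeal K {t | IsMinGen I t} := by
  refine le_antisymm ?_ (Ideal.span_le.mpr ?_)
  · obtain ⟨S, hS⟩ := hI
    conv_lhs => rw [hS]
    refine Ideal.span_le.mpr ?_
    rintro _ ⟨t, ht, rfl⟩
    have htI : ∏ i ∈ t, (X i : MvPolynomial (Fin n) K) ∈ I := by
      rw [hS]
      exact Ideal.subset_span ⟨t, ht, rfl⟩
    obtain ⟨t', hle, hmin⟩ := exists_minimal_le_of_wellFoundedLT
      (fun t : Finset (Fin n) => ∏ i ∈ t, (X i : MvPolynomial (Fin n) K) ∈ I) t htI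
    exact Ideal.mem_of_dvd _ (Finset.prod_dvd_prod_of_subset _ _ _ hle)
      (prod_X_mem_edgeIdeal ⟨hmin.prop, fun _ hlt => hmin.not_prop_of_lt hlt⟩)
  · rintro _ ⟨t, ht, rfl⟩
    exact ht.1

/-- If `I` is normally torsion-free square-free and `h = ∏_{i ∈ e} x_i` is a square-free
monomial such that `gcd(h,u) ∈ {1, x_r, x_r x_s}` for all minimal generators `u` of `I`,
then `I + (h)` is normally torsion-free. -/
theorem ntf_add_principal
    (I : Ideal (MvPolynomial (Fin n) K)) (hIsf : IsSqFreeMonomialIdeal I)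
    (hIntf : NormallyTorsionFree I) (e : Finset (Fin n))
    (r s : Fin n) (hrs : r ≠ s)
    (hgcd : ∀ t : Finset (Fin n), IsMinGen I t →
      e ∩ t = ∅ ∨ e ∩ t = {r} ∨ e ∩ t = {r, s}) :
    NormallyTorsionFree (I + Ideal.span {∏ i ∈ e, (X i : MvPolynomial (Fin n) K)}) := by
  have hI := hIsf.eq_edgeIdeal_minGen
  have hsum : I + Ideal.span {∏ i ∈ e, (X i : MvPolynomial (Fin n) K)} =
      edgeIdeal K (insert e {t | IsMinGen I t}) := by
    conv_lhs => rw [hI]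
    rw [edgeIdeal, edgeIdeal, Set.image_insert_eq, Ideal.span_insert, Submodule.add_eq_sup,
      sup_comm]
  rw [hsum]
  rw [hI] at hIntf
  exact ((isMengerian_of_normallyTorsionFree hIntf).insert_edge fun D hD =>
    card_minimal_vertexCover_inter_le_one hgcd hD).normallyTorsionFree
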